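/- If f : E → B is a Serre microfibration such that every fiber f⁻¹(b) is n-connected, then f is (n+1)-connected as a map (i.e., π_i(f) is an isomorphism for i ≤ n and surjective for i = n+1). -/

import Mathlib

open Metric

/-- A map `f : E → B` is a Serre microfibration if for every `k ≥ 0` and every
commutative square with `{0} × D^k → E` and `[0,1] × D^k → B`, there is an
`ε ∈ (0,1]` and a partial lift defined on `[0,ε) × D^k` extending the given map on
`{0} × D^k` and lifting the restriction of the bottom map. -/
def IsSerreMicrofibration {E B : Type*} [TopologicalSpace E] [TopologicalSpace B]
    (f : E → B) : Prop :=
  ∀ (k : ℕ) (g : C(Fin k → unitInterval, E))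
    (H : C(unitInterval × (Fin k → unitInterval), B)),
    (∀ x, f (g x) = H (0, x)) →
    ∃ ε : ℝ, 0 < ε ∧ ε ≤ 1 ∧
      ∃ L : C({q : unitInterval × (Fin k → unitInterval) // (q.1 : ℝ) < ε}, E),
        (∀ q, f (L q) = H q.1) ∧
        ∀ (x : Fin k → unitInterval) (h : ((0 : unitInterval) : ℝ) < ε),
          L ⟨(0, x), h⟩ = g x

/-- A space is `n`-connected if it is nonempty, path-connected, and its homotopy
groups `π_i` vanish for `1 ≤ i ≤ n`. -/
def NConnectedSpace (n : ℕ) (X : Type*) [TopologicalSpace X] : Prop :=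
  Nonempty X ∧ PathConnectedSpace X ∧
    ∀ (x : X) (i : ℕ), 1 ≤ i → i ≤ n → Subsingleton (HomotopyGroup (Fin i) X x)

/-- The inclusion of the unit sphere into the closed unit disk in `ℝ^m`. -/
noncomputable def sphereToDisk (m : ℕ) :
    C(sphere (0 : EuclideanSpace ℝ (Fin m)) 1,
      closedBall (0 : EuclideanSpace ℝ (Fin m)) 1) :=
  ⟨fun x => ⟨x.1, sphere_subset_closedBall x.2⟩,
    Continuous.subtype_mk continuous_subtype_val _⟩

open Set Topology

section Aux

/-- Radial rescaling of a continuous linear equivalence is continuous. -/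
lemma radial_continuous {V W : Type*} [NormedAddCommGroup V] [NormedSpace ℝ V]
    [NormedAddCommGroup W] [NormedSpace ℝ W] (A : V ≃L[ℝ] W) :
    Continuous (fun v : V => (‖v‖ / ‖A v‖) • A v) := by
  refine continuous_iff_continuousAt.2 fun x => ?_
  rcases eq_or_ne x 0 with rfl | hx
  · rw [ContinuousAt]
    simp only [map_zero, smul_zero]
    refine squeeze_zero_norm (a := fun v : V => ‖v‖) (fun v => ?_) ?_
    · rcases eq_or_ne v 0 with rfl | hv
      · simp
      · have : ‖A v‖ ≠ 0 := by simpa using hv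
        rw [norm_smul, norm_div, norm_norm, norm_norm, div_mul_cancel₀ _ this]
    · simpa using (continuous_norm (E := V)).tendsto 0
  · have : ‖A x‖ ≠ 0 := by simpa using hx
    exact (continuousAt_id.norm.div A.continuous.continuousAt.norm this).smul
      A.continuous.continuousAt

lemma radial_norm {V W : Type*} [NormedAddCommGroup V] [NormedSpace ℝ V]
    [NormedAddCommGroup W] [NormedSpace ℝ W] (A : V ≃L[ℝ] W) (v : V) :
    ‖(‖v‖ / ‖A v‖) • A v‖ = ‖v‖ := by
  rcases eq_or_ne v 0 with rfl | hv
  · simp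
  · have : ‖A v‖ ≠ 0 := by simpa using hv
    rw [norm_smul, norm_div, norm_norm, norm_norm, div_mul_cancel₀ _ this]

lemma radial_inv {V W : Type*} [NormedAddCommGroup V] [NormedSpace ℝ V]
    [NormedAddCommGroup W] [NormedSpace ℝ W] (A : V ≃L[ℝ] W) (v : V) :
    (‖(‖v‖ / ‖A v‖) • A v‖ / ‖A.symm ((‖v‖ / ‖A v‖) • A v)‖) •
      A.symm ((‖v‖ / ‖A v‖) • A v) = v := by
  rcases eq_or_ne v 0 with rfl | hv
  · simp
  · have h1 : ‖A v‖ ≠ 0 := by simpa using hv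
    have h2 : ‖v‖ ≠ 0 := by simpa using hv
    rw [radial_norm]
    simp only [map_smul, ContinuousLinearEquiv.symm_apply_apply, norm_smul, norm_div, norm_norm,
      smul_smul]
    have : ‖v‖ / (‖v‖ / ‖A v‖ * ‖v‖) * (‖v‖ / ‖A v‖) = 1 := by field_simp
    rw [this, one_smul]

/-- Two normed spaces of the same finite dimension are related by a norm preserving homeomorphism. -/
lemma ball_homeo (V W : Type*) [NormedAddCommGroup V] [NormedSpace ℝ V] [FiniteDimensional ℝ V]
    [NormedAddCommGroup W] [NormedSpace ℝ W] [FiniteDimensional ℝ W]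
    (h : Module.finrank ℝ V = Module.finrank ℝ W) :
    ∃ Φ : V ≃ₜ W, ∀ v, ‖Φ v‖ = ‖v‖ := by
  let A : V ≃L[ℝ] W := ContinuousLinearEquiv.ofFinrankEq h
  exact ⟨{ toFun := fun v => (‖v‖ / ‖A v‖) • A v
           invFun := fun v => (‖v‖ / ‖A.symm v‖) • A.symm v
           left_inv := fun v => radial_inv A v
           right_inv := fun v => radial_inv A.symm v
           continuous_toFun := radial_continuous A
           continuous_invFun := radial_continuous A.symm }, fun v => radial_norm A v⟩

variable {E B : Type*} [TopologicalSpace E] [TopologicalSpace B] (f : C(E, B))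

/-- Microlifting over balls. -/
lemma micro (hm : IsSerreMicrofibration f) {U : Type*} [NormedAddCommGroup U] [NormedSpace ℝ U]
    [FiniteDimensional ℝ U] (R : ℝ) (hR : 0 < R) (g : U → E)
    (hg : ContinuousOn g (closedBall 0 R)) (H : ℝ × U → B)
    (hH : ContinuousOn H (Icc 0 1 ×ˢ closedBall 0 R))
    (hgH : ∀ u ∈ closedBall (0 : U) R, f (g u) = H (0, u)) :
    ∃ ε : ℝ, 0 < ε ∧ ε ≤ 1 ∧ ∃ L : ℝ × U → E, ContinuousOn L (Ico 0 ε ×ˢ closedBall 0 R) ∧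
      (∀ t ∈ Ico 0 ε, ∀ u ∈ closedBall (0 : U) R, f (L (t, u)) = H (t, u)) ∧
      ∀ u ∈ closedBall (0 : U) R, L (0, u) = g u := by
  classical
  obtain ⟨k, hk⟩ : ∃ k, k = Module.finrank ℝ U := ⟨_, rfl⟩
  obtain ⟨φ, hφ⟩ := ball_homeo U (Fin k → ℝ) (by simp [hk])
  let α : (Fin k → unitInterval) → U := fun x => φ.symm (fun i => R * (2 * (x i : ℝ) - 1))
  let β : U → (Fin k → unitInterval) := fun u i =>
    projIcc (0 : ℝ) 1 zero_le_one ((φ u i / R + 1) / 2)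
  have hα : Continuous α := by
    refine φ.symm.continuous.comp ?_
    fun_prop
  have hβ : Continuous β := by
    refine continuous_pi fun i => continuous_projIcc.comp ?_
    have := φ.continuous
    fun_prop
  have hαm : ∀ x, α x ∈ closedBall (0 : U) R := by
    intro x
    rw [mem_closedBall_zero_iff, ← hφ]
    simp only [α, Homeomorph.apply_symm_apply]
    rw [pi_norm_le_iff_of_nonneg hR.le]
    intro i
    have h0 := (x i).2.1
    have h1 := (x i).2.2
    rw [Real.norm_eq_abs, abs_le]
    constructor <;> nlinarith
  have hαβ : ∀ u ∈ closedBall (0 : U) R, α (β u) = u := by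
    intro u hu
    rw [mem_closedBall_zero_iff, ← hφ, pi_norm_le_iff_of_nonneg hR.le] at hu
    simp only [α, β]
    rw [Homeomorph.symm_apply_eq]
    funext i
    have h1 := hu i
    rw [Real.norm_eq_abs, abs_le] at h1
    have h2 : φ u i / R ≤ 1 := by rw [div_le_one hR]; exact h1.2
    have h3 : -1 ≤ φ u i / R := by rw [le_div_iff₀ hR]; linarith
    rw [projIcc_of_mem zero_le_one (x := (φ u i / R + 1) / 2) ⟨by linarith, by linarith⟩]
    simp only
    field_simp
    ring
  let g0 : C(Fin k → unitInterval, E) := ⟨fun x => g (α x), hg.comp_continuous hα hαm⟩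
  let H0 : C(unitInterval × (Fin k → unitInterval), B) :=
    ⟨fun q => H (q.1, α q.2), hH.comp_continuous (by fun_prop) (fun q => ⟨q.1.2, hαm q.2⟩)⟩
  obtain ⟨ε, hε, hε1, L, hL, hL0⟩ := hm k g0 H0 (fun x => by
    simpa [g0, H0] using hgH _ (hαm x))
  refine ⟨ε, hε, hε1, fun p => if h : p.1 ∈ Ico 0 ε then
    L ⟨(⟨p.1, h.1, (h.2.le.trans hε1)⟩, β p.2), h.2⟩ else g 0, ?_, ?_, ?_⟩
  · rw [continuousOn_iff_continuous_domRestrict]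
    suffices hs : Continuous (fun p : (Ico 0 ε ×ˢ closedBall (0 : U) R : Set (ℝ × U)) =>
        L ⟨(⟨p.1.1, p.2.1.1, (p.2.1.2.le.trans hε1)⟩, β p.1.2), p.2.1.2⟩) by
      refine hs.congr fun p => ?_
      simp only [domRestrict_apply]
      rw [dif_pos p.2.1]
    refine L.continuous.comp ?_
    refine Continuous.subtype_mk (Continuous.prodMk (Continuous.subtype_mk ?_ _) ?_) _
    · fun_prop
    · fun_prop
  · intro t ht u hu
    simp only
    rw [dif_pos ht, hL]
    simp only [H0, ContinuousMap.coe_mk, hαβ u hu]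
  · intro u hu
    have h0 : (0 : ℝ) ∈ Ico 0 ε := ⟨le_rfl, hε⟩
    simp only
    rw [dif_pos h0]
    have := hL0 (β u) hε
    simp only [g0, ContinuousMap.coe_mk, hαβ u hu] at this
    exact this
lemma glue_cont {X Y : Type*} [TopologicalSpace X] [TopologicalSpace Y] {s t u : Set X}
    (hs : IsClosed s) (ht : IsClosed t) (hu : u ⊆ s ∪ t) (F : X → Y)
    (h1 : ContinuousOn F (u ∩ s)) (h2 : ContinuousOn F (u ∩ t)) : ContinuousOn F u := by
  have key : ∀ r : Set X, IsClosed r → ContinuousOn F (u ∩ r) →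
      ∀ x ∈ u, ContinuousWithinAt F (u ∩ r) x := by
    intro r hr h x hx
    by_cases hxr : x ∈ r
    · exact h x ⟨hx, hxr⟩
    · refine continuousWithinAt_of_notMem_closure fun hc => hxr ?_
      have := closure_mono inter_subset_right hc
      rwa [hr.closure_eq] at this
  intro x hx
  have := (key s hs h1 x hx).union (key t ht h2 x hx)
  rw [← inter_union_distrib_left, inter_eq_left.2 hu] at this
  exact this

variable {U : Type*} [NormedAddCommGroup U]

/-- `Λ` is a lift of `H` over `[a,b] × D` extending `lam` on `[a,b] × S`. -/
structure IsLift (H : ℝ × U → B) (lam : ℝ × U → E) (a b : ℝ) (Λ : ℝ × U → E) : Prop where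
  cont : ContinuousOn Λ (Icc a b ×ˢ closedBall 0 1)
  lift : ∀ t ∈ Icc a b, ∀ u ∈ closedBall (0 : U) 1, f (Λ (t, u)) = H (t, u)
  bdry : ∀ t ∈ Icc a b, ∀ u ∈ sphere (0 : U) 1, Λ (t, u) = lam (t, u)

/-- `g` is a lift of `H` over `{t} × D` extending `lam` on `{t} × S`. -/
structure IsSlice (H : ℝ × U → B) (lam : ℝ × U → E) (t : ℝ) (g : U → E) : Prop where
  cont : ContinuousOn g (closedBall 0 1)
  lift : ∀ u ∈ closedBall (0 : U) 1, f (g u) = H (t, u)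
  bdry : ∀ u ∈ sphere (0 : U) 1, g u = lam (t, u)

variable {f}

lemma IsLift.mono {H : ℝ × U → B} {lam : ℝ × U → E} {a b a' b' : ℝ} {Λ : ℝ × U → E}
    (h : IsLift f H lam a b Λ) (ha : a ≤ a') (hb : b' ≤ b) : IsLift f H lam a' b' Λ :=
  ⟨h.cont.mono (prod_mono_left (Icc_subset_Icc ha hb)),
    fun t ht => h.lift t (Icc_subset_Icc ha hb ht),
    fun t ht => h.bdry t (Icc_subset_Icc ha hb ht)⟩

lemma IsLift.slice {H : ℝ × U → B} {lam : ℝ × U → E} {a b : ℝ} {Λ : ℝ × U → E}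
    (h : IsLift f H lam a b Λ) {t : ℝ} (ht : t ∈ Icc a b) :
    IsSlice f H lam t (fun u => Λ (t, u)) :=
  ⟨h.cont.comp (by fun_prop) (fun u hu => ⟨ht, hu⟩), h.lift t ht, h.bdry t ht⟩

lemma IsLift.glue {H : ℝ × U → B} {lam : ℝ × U → E} {a b c : ℝ} {L₁ L₂ : ℝ × U → E}
    (h1 : IsLift f H lam a b L₁) (h2 : IsLift f H lam b c L₂) (hab : a ≤ b) (hbc : b ≤ c)
    (h : ∀ u ∈ closedBall (0 : U) 1, L₁ (b, u) = L₂ (b, u)) :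
    ∃ Λ, IsLift f H lam a c Λ ∧ (∀ u ∈ closedBall (0 : U) 1, Λ (a, u) = L₁ (a, u)) ∧
      (∀ u ∈ closedBall (0 : U) 1, Λ (c, u) = L₂ (c, u)) := by
  classical
  let Λ : ℝ × U → E := fun p => if p.1 ≤ b then L₁ p else L₂ p
  have hΛ1 : ∀ p : ℝ × U, p.1 ≤ b → Λ p = L₁ p := fun p hp => if_pos hp
  have hΛ2 : ∀ p : ℝ × U, b ≤ p.1 → p.2 ∈ closedBall (0 : U) 1 → Λ p = L₂ p := by
    rintro ⟨t, u⟩ hp hu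
    rcases eq_or_lt_of_le hp with he | hlt
    · simp only at he hu
      subst he
      rw [hΛ1 _ le_rfl, h u hu]
    · exact if_neg (not_le.2 hlt)
  refine ⟨Λ, ⟨?_, ?_, ?_⟩, ?_, ?_⟩
  · refine glue_cont (s := {p : ℝ × U | p.1 ≤ b}) (t := {p : ℝ × U | b ≤ p.1})
      (isClosed_le continuous_fst continuous_const) (isClosed_le continuous_const continuous_fst)
      (fun p _ => by simpa using le_total _ _) _ ?_ ?_
    · refine (h1.cont.mono ?_).congr (fun p hp => hΛ1 p hp.2)
      rintro p ⟨⟨hp1, hp2⟩, hp3⟩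
      exact ⟨⟨hp1.1, hp3⟩, hp2⟩
    · refine (h2.cont.mono ?_).congr (fun p hp => hΛ2 p hp.2 hp.1.2)
      rintro p ⟨⟨hp1, hp2⟩, hp3⟩
      exact ⟨⟨hp3, hp1.2⟩, hp2⟩
  · intro t ht u hu
    rcases le_total t b with htb | htb
    · rw [hΛ1 _ htb, h1.lift t ⟨ht.1, htb⟩ u hu]
    · rw [hΛ2 _ htb hu, h2.lift t ⟨htb, ht.2⟩ u hu]
  · intro t ht u hu
    rcases le_total t b with htb | htb
    · rw [hΛ1 _ htb, h1.bdry t ⟨ht.1, htb⟩ u hu]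
    · rw [hΛ2 _ htb (sphere_subset_closedBall hu), h2.bdry t ⟨htb, ht.2⟩ u hu]
  · intro u hu
    exact hΛ1 _ hab
  · intro u hu
    exact hΛ2 _ hbc hu

variable [NormedSpace ℝ U] [FiniteDimensional ℝ U]

/-- Relative microlifting. -/
lemma thick (hm : IsSerreMicrofibration f) (b δ : ℝ) (hδ : 0 < δ) (g : U → E) (H : ℝ × U → B)
    (lam : ℝ × U → E) (hH : ContinuousOn H (Icc b (b + δ) ×ˢ closedBall 0 1))
    (hlam : ContinuousOn lam (Icc b (b + δ) ×ˢ sphere 0 1))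
    (hfl : ∀ t ∈ Icc b (b + δ), ∀ u ∈ sphere (0 : U) 1, f (lam (t, u)) = H (t, u))
    (hg : IsSlice f H lam b g) :
    ∃ ε, 0 < ε ∧ ε ≤ δ ∧ ∃ Λ, IsLift f H lam b (b + ε) Λ ∧
      ∀ u ∈ closedBall (0 : U) 1, Λ (b, u) = g u := by
  classical
  let r : U → U := fun y => (max 1 ‖y‖)⁻¹ • y
  let ht : U → ℝ := fun y => max (‖y‖ - 1) 0
  have hmax : ∀ y : U, max 1 ‖y‖ ≠ 0 := fun y => (lt_of_lt_of_le one_pos (le_max_left _ _)).ne'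
  have hr : Continuous r := by
    refine Continuous.smul (Continuous.inv₀ (by fun_prop) hmax) continuous_id
  have hht : Continuous ht := by fun_prop
  have hht0 : ∀ y, 0 ≤ ht y := fun y => le_max_right _ _
  have hr1 : ∀ y, ‖y‖ ≤ 1 → r y = y := fun y hy => by simp [r, max_eq_left hy]
  have hht1 : ∀ y, ‖y‖ ≤ 1 → ht y = 0 := fun y hy => max_eq_right (by linarith)
  have hr2 : ∀ y, 1 ≤ ‖y‖ → r y = ‖y‖⁻¹ • y := fun y hy => by simp [r, max_eq_right hy]
  have hr3 : ∀ y, 1 ≤ ‖y‖ → r y ∈ sphere (0 : U) 1 := fun y hy => by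
    rw [mem_sphere_zero_iff_norm, hr2 y hy, norm_smul, norm_inv, norm_norm, inv_mul_cancel₀]
    linarith
  have hr4 : ∀ y, ‖r y‖ ≤ 1 := fun y => by
    rcases le_total ‖y‖ 1 with hy | hy
    · rwa [hr1 y hy]
    · simpa using (mem_sphere_zero_iff_norm.1 (hr3 y hy)).le
  have hht2 : ∀ y, 1 ≤ ‖y‖ → ht y = ‖y‖ - 1 := fun y hy => max_eq_left (by linarith)
  have hmem : ∀ x : ℝ, 0 ≤ x → b + min δ x ∈ Icc b (b + δ) := fun x hx =>
    ⟨by have := le_min hδ.le hx; linarith, by have := min_le_left δ x; linarith⟩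
  let g' : U → E := fun y => if ‖y‖ ≤ 1 then g y else lam (b + min δ (ht y), r y)
  have hg'1 : ∀ y, ‖y‖ ≤ 1 → g' y = g y := fun y hy => if_pos hy
  have hg'2 : ∀ y, 1 ≤ ‖y‖ → g' y = lam (b + min δ (ht y), r y) := by
    intro y hy
    rcases eq_or_lt_of_le hy with he | hlt
    · rw [hg'1 y he.ge, hht1 y he.ge, hr1 y he.ge, min_eq_right hδ.le, add_zero]
      exact hg.bdry y (by simp [← he])
    · exact if_neg (not_le.2 hlt)
  have hg'c : Continuous g' := by
    rw [← continuousOn_univ]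
    refine glue_cont (s := {y : U | ‖y‖ ≤ 1}) (t := {y : U | 1 ≤ ‖y‖})
      (isClosed_le continuous_norm continuous_const) (isClosed_le continuous_const continuous_norm)
      (fun p _ => by simpa using le_total _ _) _ ?_ ?_
    · refine (hg.cont.mono ?_).congr (fun y hy => hg'1 y hy.2)
      intro y hy
      simpa using hy.2
    · refine ContinuousOn.congr (f := fun y => lam (b + min δ (ht y), r y)) ?_
        (fun y hy => hg'2 y hy.2)
      refine hlam.comp (by fun_prop) ?_
      intro y hy
      exact ⟨hmem _ (hht0 y), hr3 y hy.2⟩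
  let H' : ℝ × U → B := fun p => H (b + min δ (ht p.2 + p.1), (1 - p.1) • r p.2)
  have hH'm : ∀ p ∈ Icc (0 : ℝ) 1 ×ˢ (closedBall (0 : U) 2),
      (b + min δ (ht p.2 + p.1), (1 - p.1) • r p.2) ∈ Icc b (b + δ) ×ˢ closedBall (0 : U) 1 := by
    rintro ⟨s, y⟩ ⟨hs, -⟩
    refine ⟨hmem _ (add_nonneg (hht0 y) hs.1), ?_⟩
    rw [mem_closedBall_zero_iff]
    simp only [norm_smul, Real.norm_eq_abs]
    rw [abs_of_nonneg (by linarith [hs.2])]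
    have := hr4 y
    have := norm_nonneg (r y)
    have := hs.1
    simp only at this
    nlinarith [hs.2]
  have hH'c : ContinuousOn H' (Icc 0 1 ×ˢ closedBall 0 2) := by
    refine hH.comp (Continuous.continuousOn (by fun_prop)) hH'm
  obtain ⟨ε₀, hε₀, hε₀1, L, hLc, hL, hL0⟩ := micro f hm 2 two_pos g' hg'c.continuousOn H' hH'c (by
    intro y _
    simp only [H', sub_zero, one_smul, add_zero]
    rcases le_total ‖y‖ 1 with hy | hy
    · rw [hg'1 y hy, hht1 y hy, hr1 y hy, min_eq_right hδ.le, add_zero]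
      exact hg.lift y (by simpa using hy)
    · rw [hg'2 y hy]
      exact hfl _ (hmem _ (hht0 y)) _ (hr3 y hy))
  let s : ℝ × U → ℝ := fun p => min (p.1 - b) (1 - ‖p.2‖)
  let q : ℝ × U → U := fun p => ((1 + (p.1 - b) - s p) / (1 - s p)) • p.2
  have hsc : Continuous s := by fun_prop
  refine ⟨min δ (ε₀ / 2), by positivity, min_le_left _ _, fun p => L (s p, q p), ?_, ?_⟩
  · set ε := min δ (ε₀ / 2) with hεdef
    have hεδ : ε ≤ δ := min_le_left _ _
    have hε2 : ε ≤ ε₀ / 2 := min_le_right _ _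
    have facts : ∀ t ∈ Icc b (b + ε), ∀ z ∈ closedBall (0 : U) 1,
        s (t, z) ∈ Ico 0 ε₀ ∧ s (t, z) ≤ 1 / 2 ∧ q (t, z) ∈ closedBall (0 : U) 2 ∧
        b + min δ (ht (q (t, z)) + s (t, z)) = t ∧ (1 - s (t, z)) • r (q (t, z)) = z := by
      intro t htt z hz
      rw [mem_closedBall_zero_iff] at hz
      have h1 : s (t, z) ≤ t - b := min_le_left _ _
      have h1' : s (t, z) ≤ 1 - ‖z‖ := min_le_right _ _
      have h2 : 0 ≤ s (t, z) := le_min (by linarith [htt.1]) (by simpa using hz)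
      have h3 := htt.2
      refine ⟨⟨h2, by linarith⟩, by linarith, ?_⟩
      rcases le_total (t - b) (1 - ‖z‖) with hc | hc
      · have hs : s (t, z) = t - b := min_eq_left hc
        have hq : q (t, z) = (1 - (t - b))⁻¹ • z := by
          simp only [q, hs, add_sub_cancel_right, one_div]
        have hpos : 0 < 1 - (t - b) := by linarith
        have hq1 : ‖q (t, z)‖ ≤ 1 := by
          rw [hq, norm_smul, norm_inv, Real.norm_eq_abs, abs_of_pos hpos, inv_mul_le_iff₀ hpos]
          linarith
        refine ⟨by rw [mem_closedBall_zero_iff]; linarith, ?_, ?_⟩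
        · rw [hht1 _ hq1, zero_add, hs, min_eq_right (by linarith)]; ring
        · rw [hr1 _ hq1, hs, hq, smul_smul, mul_inv_cancel₀ hpos.ne', one_smul]
      · have hs : s (t, z) = 1 - ‖z‖ := min_eq_right hc
        have hz0 : 0 < ‖z‖ := by linarith
        have hq : q (t, z) = ((t - b + ‖z‖) / ‖z‖) • z := by
          simp only [q, hs]
          congr 2 <;> ring
        have hqn : ‖q (t, z)‖ = t - b + ‖z‖ := by
          rw [hq, norm_smul, Real.norm_eq_abs, abs_of_nonneg, div_mul_cancel₀ _ hz0.ne']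
          exact div_nonneg (by linarith) hz0.le
        have hqn1 : 1 ≤ ‖q (t, z)‖ := by linarith
        refine ⟨by rw [mem_closedBall_zero_iff]; linarith, ?_, ?_⟩
        · rw [hht2 _ hqn1, hs, hqn, min_eq_right (by linarith)]; ring
        · rw [hr2 _ hqn1, hs, hqn, hq, smul_smul, smul_smul]
          have hne : t - b + ‖z‖ ≠ 0 := by linarith
          have : (1 - (1 - ‖z‖)) * (t - b + ‖z‖)⁻¹ * ((t - b + ‖z‖) / ‖z‖) = 1 := by
            field_simp; ring
          rw [this, one_smul]
    refine ⟨?_, ?_, ?_⟩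
    · refine hLc.comp ?_ ?_
      · refine hsc.continuousOn.prodMk ?_
        refine ContinuousOn.smul (ContinuousOn.div (by fun_prop) (by fun_prop) ?_) (by fun_prop)
        rintro ⟨t, z⟩ ⟨h1, h2⟩
        have := (facts t h1 z h2).2.1
        linarith
      · rintro ⟨t, z⟩ ⟨h1, h2⟩
        have := facts t h1 z h2
        exact ⟨this.1, this.2.2.1⟩
    · intro t h1 z h2
      obtain ⟨c1, c2, c3, c4, c5⟩ := facts t h1 z h2
      rw [hL _ c1 _ c3]
      simp only [H']
      rw [c4, c5]
    · intro t h1 z h2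
      obtain ⟨c1, c2, c3, c4, c5⟩ := facts t h1 z (sphere_subset_closedBall h2)
      rw [mem_sphere_zero_iff_norm] at h2
      have hs : s (t, z) = 0 := by
        simp only [s, h2, sub_self]
        exact min_eq_right (by linarith [h1.1])
      simp only [hs, sub_zero, one_smul, add_zero] at c4 c5 ⊢
      rw [hL0 _ c3]
      have hqn : 1 ≤ ‖q (t, z)‖ := by
        simp only [q, hs, sub_zero, div_one, norm_smul, h2, mul_one, Real.norm_eq_abs]
        rw [abs_of_nonneg] <;> linarith [h1.1]
      rw [hg'2 _ hqn, c4, c5]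
  · intro z hz
    rw [mem_closedBall_zero_iff] at hz
    have hs : s (b, z) = 0 := by
      simp only [s, sub_self]
      exact min_eq_left (by linarith)
    have hq : q (b, z) = z := by simp [q, hs]
    simp only [hs, hq]
    rw [hL0 _ (by rw [mem_closedBall_zero_iff]; linarith), hg'1 _ hz]
end Aux

section Aux
variable {E B : Type*} [TopologicalSpace E] [TopologicalSpace B] {f : C(E, B)}
lemma mem_cb_prod {X Y : Type*} [NormedAddCommGroup X] [NormedAddCommGroup Y] (p : X × Y) :
    p ∈ closedBall (0 : X × Y) 1 ↔ ‖p.1‖ ≤ 1 ∧ ‖p.2‖ ≤ 1 := by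
  rw [mem_closedBall_zero_iff, Prod.norm_def, max_le_iff]

lemma mem_sph_prod {X Y : Type*} [NormedAddCommGroup X] [NormedAddCommGroup Y] (p : X × Y) :
    p ∈ sphere (0 : X × Y) 1 ↔ (‖p.1‖ ≤ 1 ∧ ‖p.2‖ ≤ 1) ∧ (‖p.1‖ = 1 ∨ ‖p.2‖ = 1) := by
  rw [mem_sphere_zero_iff_norm, Prod.norm_def]
  constructor
  · intro h
    refine ⟨max_le_iff.1 h.le, ?_⟩
    rcases max_choice ‖p.1‖ ‖p.2‖ with h' | h' <;> rw [h'] at h <;> simp [h]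
  · rintro ⟨⟨h1, h2⟩, h3 | h3⟩
    · rw [h3]; exact max_eq_left h2
    · rw [h3]; exact max_eq_right h1

/-- The data of a lifting problem on `ℝ × D` which can be filled slicewise. -/
structure Slab {U : Type*} [NormedAddCommGroup U] (f : C(E, B)) (H : ℝ × U → B)
    (lam : ℝ × U → E) : Prop where
  contH : ContinuousOn H (univ ×ˢ closedBall 0 1)
  contlam : ContinuousOn lam (univ ×ˢ sphere 0 1)
  lift : ∀ t, ∀ u ∈ sphere (0 : U) 1, f (lam (t, u)) = H (t, u)
  slice : ∀ t, ∃ g, IsSlice f H lam t g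
  fill : ∀ t g₀ g₁, IsSlice f H lam t g₀ → IsSlice f H lam t g₁ → ∃ M : U × ℝ → E,
    ContinuousOn M (closedBall 0 1) ∧ (∀ p ∈ closedBall (0 : U × ℝ) 1, f (M p) = H (t, p.1)) ∧
    (∀ u ∈ closedBall (0 : U) 1, M (u, -1) = g₀ u) ∧
    (∀ u ∈ closedBall (0 : U) 1, M (u, 1) = g₁ u) ∧
    (∀ u ∈ sphere (0 : U) 1, ∀ s ∈ Icc (-1 : ℝ) 1, M (u, s) = lam (t, u))

/-- Time reversal. -/
def rev {U X : Type*} (F : ℝ × U → X) : ℝ × U → X := fun p => F (-p.1, p.2)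

section
variable {U : Type*} [NormedAddCommGroup U] {H : ℝ × U → B} {lam : ℝ × U → E}

lemma IsSlice.rev' {t : ℝ} {g : U → E} (h : IsSlice f H lam (-t) g) :
    IsSlice f (rev H) (rev lam) t g := ⟨h.cont, h.lift, h.bdry⟩

lemma IsSlice.unrev {t : ℝ} {g : U → E} (h : IsSlice f (rev H) (rev lam) t g) :
    IsSlice f H lam (-t) g := ⟨h.cont, h.lift, h.bdry⟩

lemma IsLift.rev' {a b : ℝ} {Λ : ℝ × U → E} (h : IsLift f H lam (-b) (-a) Λ) :
    IsLift f (rev H) (rev lam) a b (rev Λ) := by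
  have hmem : ∀ t ∈ Icc a b, -t ∈ Icc (-b) (-a) := fun t ht => ⟨by linarith [ht.2], by linarith [ht.1]⟩
  refine ⟨h.cont.comp (Continuous.continuousOn (by fun_prop)) fun p hp => ⟨hmem _ hp.1, hp.2⟩,
    fun t ht u hu => h.lift _ (hmem t ht) u hu, fun t ht u hu => h.bdry _ (hmem t ht) u hu⟩

lemma rev_rev {U X : Type*} (F : ℝ × U → X) : rev (rev F) = F := by
  funext p
  simp [rev]

lemma IsLift.unrev {a b : ℝ} {Λ : ℝ × U → E} (h : IsLift f (rev H) (rev lam) (-b) (-a) Λ) :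
    IsLift f H lam a b (rev Λ) := by
  have := h.rev'
  rwa [rev_rev, rev_rev] at this

lemma Slab.rev' (h : Slab f H lam) : Slab f (rev H) (rev lam) where
  contH := h.contH.comp (Continuous.continuousOn (by fun_prop)) fun p hp => ⟨mem_univ _, hp.2⟩
  contlam := h.contlam.comp (Continuous.continuousOn (by fun_prop)) fun p hp => ⟨mem_univ _, hp.2⟩
  lift t u hu := h.lift _ u hu
  slice t := by
    obtain ⟨g, hg⟩ := h.slice (-t)
    exact ⟨g, hg.rev'⟩
  fill t g₀ g₁ h0 h1 := h.fill (-t) g₀ g₁ h0.unrev h1.unrev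

variable [NormedSpace ℝ U] [FiniteDimensional ℝ U]

lemma Slab.extend (hm : IsSerreMicrofibration f) (h : Slab f H lam) {t : ℝ} {g : U → E}
    (hg : IsSlice f H lam t g) : ∃ ε, 0 < ε ∧ ∃ Λ, IsLift f H lam t (t + ε) Λ ∧
      ∀ u ∈ closedBall (0 : U) 1, Λ (t, u) = g u := by
  obtain ⟨ε, h0, -, Λ, h1, h2⟩ := thick hm t 1 one_pos g H lam
    (h.contH.mono (prod_mono_left (subset_univ _)))
    (h.contlam.mono (prod_mono_left (subset_univ _))) (fun t _ => h.lift t) hg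
  exact ⟨ε, h0, Λ, h1, h2⟩

lemma Slab.extend_back (hm : IsSerreMicrofibration f) (h : Slab f H lam) {t : ℝ} {g : U → E}
    (hg : IsSlice f H lam t g) : ∃ ε, 0 < ε ∧ ∃ Λ, IsLift f H lam (t - ε) t Λ ∧
      ∀ u ∈ closedBall (0 : U) 1, Λ (t, u) = g u := by
  have hg' : IsSlice f (rev H) (rev lam) (-t) g := by
    apply IsSlice.rev'
    rwa [neg_neg]
  obtain ⟨ε, h0, Λ, h1, h2⟩ := h.rev'.extend hm hg'
  refine ⟨ε, h0, rev Λ, ?_, fun u hu => h2 u hu⟩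
  apply IsLift.unrev
  rwa [neg_sub', sub_neg_eq_add]

lemma Slab.fix_left (hm : IsSerreMicrofibration f) (h : Slab f H lam) {a b : ℝ} (hab : a < b)
    {L : ℝ × U → E} (hL : IsLift f H lam a b L) {g : U → E} (hg : IsSlice f H lam a g) :
    ∃ Λ, IsLift f H lam a b Λ ∧ (∀ u ∈ closedBall (0 : U) 1, Λ (a, u) = g u) ∧
      (∀ u ∈ closedBall (0 : U) 1, Λ (b, u) = L (b, u)) := by
  classical
  obtain ⟨ε₁, hε₁, K, hK, hKa⟩ := h.extend hm hg
  obtain ⟨M, hMc, hMl, hM0, hM1, hMS⟩ := h.fill a _ _ hg (hL.slice ⟨le_rfl, hab.le⟩)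
  obtain ⟨δ, hδ, hδ1, hδ2⟩ : ∃ δ, 0 < δ ∧ δ ≤ ε₁ ∧ δ ≤ b - a :=
    ⟨min ε₁ (b - a), lt_min hε₁ (by linarith), min_le_left _ _, min_le_right _ _⟩
  have hK' := hK.mono le_rfl (b' := a + δ) (by linarith)
  have hL' := hL.mono le_rfl (b' := a + δ) (by linarith)
  let H' : ℝ × (U × ℝ) → B := fun p => H (p.1, p.2.1)
  let lam' : ℝ × (U × ℝ) → E := fun p =>
    if p.2.2 = -1 then K (p.1, p.2.1) else if p.2.2 = 1 then L (p.1, p.2.1) else lam (p.1, p.2.1)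
  have l1 : ∀ t u, lam' (t, u, -1) = K (t, u) := fun t u => if_pos rfl
  have l2 : ∀ t u, lam' (t, u, 1) = L (t, u) := fun t u => by
    simp only [lam']
    norm_num
  have l3 : ∀ t ∈ Icc a (a + δ), ∀ u ∈ sphere (0 : U) 1, ∀ s, lam' (t, u, s) = lam (t, u) := by
    intro t ht u hu s
    simp only [lam']
    split_ifs
    · exact hK'.bdry t ht u hu
    · exact hL'.bdry t ht u hu
    · rfl
  have cases_sph : ∀ p : U × ℝ, p ∈ sphere (0 : U × ℝ) 1 →
      p.1 ∈ closedBall (0 : U) 1 ∧ p.2 ∈ Icc (-1 : ℝ) 1 ∧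
      (p.2 = -1 ∨ p.2 = 1 ∨ p.1 ∈ sphere (0 : U) 1) := by
    rintro ⟨u, s⟩ hp
    obtain ⟨⟨h1, h2⟩, h3⟩ := (mem_sph_prod _).1 hp
    refine ⟨by simpa using h1, abs_le.1 h2, ?_⟩
    rcases h3 with h3 | h3
    · right; right; simpa using h3
    · rcases eq_or_eq_neg_of_abs_eq (h3 : |s| = 1) with h | h
      · exact Or.inr (Or.inl h)
      · exact Or.inl h
  have q1 : ContinuousOn H' (Icc a (a + δ) ×ˢ closedBall 0 1) := by
    refine h.contH.comp (Continuous.continuousOn (by fun_prop)) ?_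
    rintro p ⟨-, hp⟩
    exact ⟨mem_univ _, by simpa using ((mem_cb_prod _).1 hp).1⟩
  have q2 : ContinuousOn lam' (Icc a (a + δ) ×ˢ sphere 0 1) := by
    refine glue_cont (s := {p : ℝ × (U × ℝ) | p.2.2 = -1})
      (t := {p : ℝ × (U × ℝ) | p.2.2 = 1} ∪ {p : ℝ × (U × ℝ) | p.2.1 ∈ sphere (0 : U) 1})
      (isClosed_eq (by fun_prop) (by fun_prop)) ((isClosed_eq (by fun_prop) (by fun_prop)).union
        (isClosed_sphere.preimage (by fun_prop))) ?_ _ ?_ ?_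
    · rintro p ⟨-, hp⟩
      exact (cases_sph _ hp).2.2
    · refine ContinuousOn.congr (f := fun p => K (p.1, p.2.1)) ?_ ?_
      · refine hK'.cont.comp (Continuous.continuousOn (by fun_prop)) ?_
        rintro p ⟨⟨hp1, hp2⟩, -⟩
        exact ⟨hp1, (cases_sph _ hp2).1⟩
      · rintro p ⟨-, hp⟩
        exact if_pos hp
    · refine glue_cont (s := {p : ℝ × (U × ℝ) | p.2.2 = 1})
        (t := {p : ℝ × (U × ℝ) | p.2.1 ∈ sphere (0 : U) 1})
        (isClosed_eq (by fun_prop) (by fun_prop))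
        (isClosed_sphere.preimage (by fun_prop)) inter_subset_right _ ?_ ?_
      · refine ContinuousOn.congr (f := fun p => L (p.1, p.2.1)) ?_ ?_
        · refine hL'.cont.comp (Continuous.continuousOn (by fun_prop)) ?_
          rintro p ⟨⟨⟨hp1, hp2⟩, -⟩, -⟩
          exact ⟨hp1, (cases_sph _ hp2).1⟩
        · rintro ⟨t, u, s⟩ ⟨-, hp⟩
          have hp' : s = 1 := hp
          rw [hp', l2]
      · refine ContinuousOn.congr (f := fun p => lam (p.1, p.2.1)) ?_ ?_
        · refine h.contlam.comp (Continuous.continuousOn (by fun_prop)) ?_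
          rintro p ⟨-, hp⟩
          exact ⟨mem_univ _, hp⟩
        · rintro ⟨t, u, s⟩ ⟨⟨⟨ht, -⟩, -⟩, hp⟩
          exact l3 t ht u hp s
  have q3 : ∀ t ∈ Icc a (a + δ), ∀ u ∈ sphere (0 : U × ℝ) 1, f (lam' (t, u)) = H' (t, u) := by
    rintro t ht ⟨u, s⟩ hp
    obtain ⟨h1, h2, h3 | h3 | h3⟩ := cases_sph _ hp
    · simp only at h3 h1
      rw [h3, l1]
      exact hK'.lift t ht u h1
    · simp only at h3 h1
      rw [h3, l2]
      exact hL'.lift t ht u h1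
    · rw [l3 t ht u h3]
      exact h.lift t u h3
  have q4 : IsSlice f H' lam' a M := by
    refine ⟨hMc, hMl, ?_⟩
    rintro ⟨u, s⟩ hp
    have haa : a ∈ Icc a (a + δ) := ⟨le_rfl, by linarith⟩
    obtain ⟨h1, h2, h3 | h3 | h3⟩ := cases_sph _ hp
    · simp only at h3 h1
      rw [h3, l1, hM0 u h1, hKa u h1]
    · simp only at h3 h1
      rw [h3, l2, hM1 u h1]
    · rw [l3 a haa u h3, hMS u h3 s h2]
  obtain ⟨ε, hε, hεδ, N, hN, hNa⟩ := thick hm a δ hδ M H' lam' q1 q2 q3 q4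
  -- the diagonal
  have hmem : ∀ t ∈ Icc a (a + ε), ∀ u ∈ closedBall (0 : U) 1,
      (u, -1 + 2 * ((t - a) / ε)) ∈ closedBall (0 : U × ℝ) 1 := by
    intro t ht u hu
    rw [mem_cb_prod]
    refine ⟨by simpa using hu, ?_⟩
    have e1 : (t - a) / ε ≤ 1 := by rw [div_le_one hε]; linarith [ht.2]
    have e2 : 0 ≤ (t - a) / ε := div_nonneg (by linarith [ht.1]) hε.le
    rw [Real.norm_eq_abs, abs_le]
    constructor <;> linarith
  have hD : IsLift f H lam a (a + ε) (fun p => N (p.1, p.2, -1 + 2 * ((p.1 - a) / ε))) := by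
    refine ⟨?_, ?_, ?_⟩
    · refine hN.cont.comp (Continuous.continuousOn (by fun_prop)) ?_
      rintro p ⟨hp1, hp2⟩
      exact ⟨hp1, hmem _ hp1 _ hp2⟩
    · intro t ht u hu
      exact hN.lift t ht _ (hmem t ht u hu)
    · intro t ht u hu
      have hu' := hmem t ht u (sphere_subset_closedBall hu)
      rw [mem_cb_prod] at hu'
      simp only
      rw [hN.bdry t ht, l3 t (Icc_subset_Icc le_rfl (by linarith) ht) u hu]
      rw [mem_sph_prod]
      exact ⟨hu', Or.inl (by simpa using hu)⟩
  obtain ⟨Λ, hΛ, hΛa, hΛb⟩ := hD.glue (hL.mono (a' := a + ε) (by linarith) le_rfl)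
    (by linarith) (by linarith) (by
      intro u hu
      have e : -1 + 2 * ((a + ε - a) / ε) = 1 := by field_simp; ring
      simp only [e]
      rw [hN.bdry _ ⟨by linarith, le_rfl⟩, l2]
      rw [mem_sph_prod]
      exact ⟨⟨by simpa using hu, by simp⟩, Or.inr (by simp)⟩)
  refine ⟨Λ, hΛ, ?_, hΛb⟩
  intro u hu
  have e : -1 + 2 * ((a - a) / ε) = -1 := by simp
  rw [hΛa u hu]
  simp only [e]
  rw [hNa _ (by rw [mem_cb_prod]; exact ⟨by simpa using hu, by simp⟩), hM0 u hu]

lemma Slab.fix_right (hm : IsSerreMicrofibration f) (h : Slab f H lam) {a b : ℝ} (hab : a < b)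
    {L : ℝ × U → E} (hL : IsLift f H lam a b L) {g : U → E} (hg : IsSlice f H lam b g) :
    ∃ Λ, IsLift f H lam a b Λ ∧ (∀ u ∈ closedBall (0 : U) 1, Λ (b, u) = g u) ∧
      (∀ u ∈ closedBall (0 : U) 1, Λ (a, u) = L (a, u)) := by
  have hL' : IsLift f (rev H) (rev lam) (-b) (-a) (rev L) := by
    apply IsLift.rev'
    rwa [neg_neg, neg_neg]
  have hg' : IsSlice f (rev H) (rev lam) (-b) g := by
    apply IsSlice.rev'
    rwa [neg_neg]
  obtain ⟨Λ, h1, h2, h3⟩ := h.rev'.fix_left hm (neg_lt_neg hab) hL' hg'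
  refine ⟨rev Λ, h1.unrev, fun u hu => h2 u hu, fun u hu => ?_⟩
  rw [rev, h3 u hu, rev, neg_neg]

/-- Every pair of end slices over `[a,b]` can be joined by a lift. -/
lemma Slab.solve (hm : IsSerreMicrofibration f) (h : Slab f H lam) {a b : ℝ} (hab : a < b)
    {g₀ g₁ : U → E} (hg₀ : IsSlice f H lam a g₀) (hg₁ : IsSlice f H lam b g₁) :
    ∃ Λ, IsLift f H lam a b Λ ∧ (∀ u ∈ closedBall (0 : U) 1, Λ (a, u) = g₀ u) ∧
      (∀ u ∈ closedBall (0 : U) 1, Λ (b, u) = g₁ u) := by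
  let P : ℝ → ℝ → Prop := fun a b => a < b → ∀ g₀ g₁, IsSlice f H lam a g₀ →
    IsSlice f H lam b g₁ → ∃ Λ, IsLift f H lam a b Λ ∧
      (∀ u ∈ closedBall (0 : U) 1, Λ (a, u) = g₀ u) ∧
      (∀ u ∈ closedBall (0 : U) 1, Λ (b, u) = g₁ u)
  have trans : ∀ a b c, a ≤ b → b ≤ c → P a b → P b c → P a c := by
    intro a b c hab hbc h1 h2
    rcases eq_or_lt_of_le hab with rfl | hab'
    · exact h2
    rcases eq_or_lt_of_le hbc with rfl | hbc'
    · exact h1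
    intro _ g₀ g₁ hg₀ hg₁
    obtain ⟨g, hg⟩ := h.slice b
    obtain ⟨L₁, hL₁, e1, e2⟩ := h1 hab' g₀ g hg₀ hg
    obtain ⟨L₂, hL₂, e3, e4⟩ := h2 hbc' g g₁ hg hg₁
    obtain ⟨Λ, hΛ, e5, e6⟩ := hL₁.glue hL₂ hab hbc (fun u hu => by rw [e2 u hu, e3 u hu])
    exact ⟨Λ, hΛ, fun u hu => by rw [e5 u hu, e1 u hu], fun u hu => by rw [e6 u hu, e4 u hu]⟩
  have loc : ∀ t : ℝ, ∃ ε, 0 < ε ∧ ∀ a b, a ∈ ball t ε → b ∈ ball t ε → P a b := by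
    intro t
    obtain ⟨g, hg⟩ := h.slice t
    obtain ⟨ε₁, hε₁, L₁, hL₁, e1⟩ := h.extend_back hm hg
    obtain ⟨ε₂, hε₂, L₂, hL₂, e2⟩ := h.extend hm hg
    obtain ⟨L, hL, -, -⟩ := hL₁.glue hL₂ (by linarith) (by linarith)
      (fun u hu => by rw [e1 u hu, e2 u hu])
    refine ⟨min ε₁ ε₂, lt_min hε₁ hε₂, ?_⟩
    intro a b ha hb hab g₀ g₁ hg₀ hg₁
    rw [Real.ball_eq_Ioo] at ha hb
    have i1 := min_le_left ε₁ ε₂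
    have i2 := min_le_right ε₁ ε₂
    have hL' := hL.mono (a' := a) (b' := b) (by linarith [ha.1]) (by linarith [hb.2])
    obtain ⟨L₃, hL₃, e3, e4⟩ := h.fix_left hm hab hL' hg₀
    obtain ⟨L₄, hL₄, e5, e6⟩ := h.fix_right hm hab hL₃ hg₁
    exact ⟨L₄, hL₄, fun u hu => by rw [e6 u hu, e3 u hu], e5⟩
  choose ε hε hloc using loc
  obtain ⟨t, ht0, htm, ⟨m, hm'⟩, hc⟩ := exists_monotone_Icc_subset_open_cover_Icc hab.le
    (c := fun i : ℝ => (Subtype.val ⁻¹' (ball i (ε i)) : Set (Icc a b)))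
    (fun i => isOpen_ball.preimage continuous_subtype_val)
    (fun x _ => mem_iUnion.2 ⟨x.1, mem_ball_self (hε _)⟩)
  have key : ∀ n, P a (t n) := by
    intro n
    induction n with
    | zero => intro hlt; rw [ht0] at hlt; exact absurd hlt (lt_irrefl _)
    | succ n ih =>
      refine trans a (t n) (t (n + 1)) (t n).2.1 (htm n.le_succ) ih ?_
      obtain ⟨i, hi⟩ := hc n
      exact hloc i _ _ (hi ⟨le_rfl, htm n.le_succ⟩) (hi ⟨htm n.le_succ, le_rfl⟩)
  have := key m
  rw [hm' m le_rfl] at this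
  exact this hab g₀ g₁ hg₀ hg₁
end
/-- Wrapping a ball of radius `4` around the sphere one dimension up. -/
noncomputable def wrap {Y : Type*} [NormedAddCommGroup Y] [NormedSpace ℝ Y] (y : Y) : Y × ℝ :=
  ((min 1 (4 - ‖y‖) / max 1 ‖y‖) • y, max (-1) (min 1 (2 - ‖y‖)))

section
variable {Y : Type*} [NormedAddCommGroup Y] [NormedSpace ℝ Y]

lemma wrap_cont : Continuous (wrap : Y → Y × ℝ) := by
  have hmax : ∀ y : Y, max 1 ‖y‖ ≠ 0 := fun y => (lt_of_lt_of_le one_pos (le_max_left _ _)).ne'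
  unfold wrap
  refine Continuous.prodMk (Continuous.smul (Continuous.div ?_ ?_ hmax) continuous_id) ?_ <;> fun_prop

lemma wrap_1 {y : Y} (h : ‖y‖ ≤ 1) : wrap y = (y, 1) := by
  have h1 : min 1 (4 - ‖y‖) = 1 := min_eq_left (by linarith)
  have h2 : max 1 ‖y‖ = 1 := max_eq_left h
  have h3 : min 1 (2 - ‖y‖) = 1 := min_eq_left (by linarith)
  simp [wrap, h1, h2, h3]

lemma wrap_2 {y : Y} (h : 1 ≤ ‖y‖) (h' : ‖y‖ ≤ 3) : wrap y = (‖y‖⁻¹ • y, 2 - ‖y‖) := by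
  have h1 : min 1 (4 - ‖y‖) = 1 := min_eq_left (by linarith)
  have h2 : max 1 ‖y‖ = ‖y‖ := max_eq_right h
  have h3 : min 1 (2 - ‖y‖) = 2 - ‖y‖ := min_eq_right (by linarith)
  have h4 : max (-1) (2 - ‖y‖) = 2 - ‖y‖ := max_eq_right (by linarith)
  simp [wrap, h1, h2, h3, h4]

lemma wrap_3 {y : Y} (h : 3 ≤ ‖y‖) : wrap y = (((4 - ‖y‖) / ‖y‖) • y, -1) := by
  have h1 : min 1 (4 - ‖y‖) = 4 - ‖y‖ := min_eq_right (by linarith)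
  have h2 : max 1 ‖y‖ = ‖y‖ := max_eq_right (by linarith)
  have h3 : min 1 (2 - ‖y‖) = 2 - ‖y‖ := min_eq_right (by linarith)
  have h4 : max (-1) (2 - ‖y‖) = -1 := max_eq_left (by linarith)
  simp [wrap, h1, h2, h3, h4]

lemma wrap_fst_2 {y : Y} (h : 1 ≤ ‖y‖) : ‖‖y‖⁻¹ • y‖ = 1 := by
  rw [norm_smul, norm_inv, norm_norm, inv_mul_cancel₀]; linarith

lemma wrap_fst_3 {y : Y} (h : 3 ≤ ‖y‖) (h' : ‖y‖ ≤ 4) :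
    ‖((4 - ‖y‖) / ‖y‖) • y‖ = 4 - ‖y‖ := by
  have : 0 < ‖y‖ := by linarith
  rw [norm_smul, Real.norm_eq_abs, abs_of_nonneg (div_nonneg (by linarith) this.le),
    div_mul_cancel₀ _ this.ne']

lemma wrap_mem {y : Y} (h : ‖y‖ ≤ 4) : wrap y ∈ sphere (0 : Y × ℝ) 1 := by
  rw [mem_sph_prod]
  rcases le_total ‖y‖ 1 with h1 | h1
  · rw [wrap_1 h1]; simp [h1]
  rcases le_total ‖y‖ 3 with h3 | h3
  · rw [wrap_2 h1 h3]
    simp only [wrap_fst_2 h1, Real.norm_eq_abs, le_refl, true_and, true_or, and_true]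
    rw [abs_le]; constructor <;> linarith
  · rw [wrap_3 h3]
    simp only [wrap_fst_3 h3 h]
    simp; linarith

lemma wrap_norm_eq {y y' : Y} (h : ‖y‖ ≤ 4) (h' : ‖y'‖ ≤ 4) (he : wrap y = wrap y') :
    ‖y‖ = ‖y'‖ := by
  have key : ∀ y : Y, ‖y‖ ≤ 4 → (‖(wrap y).1‖ = ‖y‖ ∧ (wrap y).2 = 1 ∧ ‖y‖ ≤ 1) ∨
      (‖(wrap y).1‖ = 1 ∧ (wrap y).2 = 2 - ‖y‖ ∧ 1 ≤ ‖y‖ ∧ ‖y‖ ≤ 3) ∨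
      (‖(wrap y).1‖ = 4 - ‖y‖ ∧ (wrap y).2 = -1 ∧ 3 ≤ ‖y‖) := by
    intro y h
    rcases le_total ‖y‖ 1 with h1 | h1
    · left; rw [wrap_1 h1]; simp [h1]
    rcases le_total ‖y‖ 3 with h3 | h3
    · right; left; rw [wrap_2 h1 h3]; exact ⟨wrap_fst_2 h1, rfl, h1, h3⟩
    · right; right; rw [wrap_3 h3]; exact ⟨wrap_fst_3 h3 h, rfl, h3⟩
  have k1 := key y h
  have k2 := key y' h'
  rw [he] at k1
  rcases k1 with ⟨a1, a2, a3⟩ | ⟨a1, a2, a3⟩ | ⟨a1, a2, a3⟩ <;>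
  rcases k2 with ⟨b1, b2, b3⟩ | ⟨b1, b2, b3⟩ | ⟨b1, b2, b3⟩ <;> linarith

lemma wrap_inj {y y' : Y} (h : ‖y‖ ≤ 4) (h' : ‖y'‖ ≤ 4) (he : wrap y = wrap y') :
    y = y' ∨ (‖y‖ = 4 ∧ ‖y'‖ = 4) := by
  have hn := wrap_norm_eq h h' he
  rcases eq_or_lt_of_le h with h4 | h4
  · exact Or.inr ⟨h4, hn ▸ h4⟩
  · left
    have h1 := congrArg Prod.fst he
    simp only [wrap, ← hn] at h1
    have hc : min 1 (4 - ‖y‖) / max 1 ‖y‖ ≠ 0 := by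
      have : 0 < min 1 (4 - ‖y‖) := lt_min one_pos (by linarith)
      have : 0 < max 1 ‖y‖ := lt_of_lt_of_le one_pos (le_max_left _ _)
      positivity
    exact smul_right_injective Y hc h1

lemma wrap_four {y : Y} (h : ‖y‖ = 4) : wrap y = (0, -1) := by
  rw [wrap_3 (by linarith), h]; simp

lemma wrap_surj [Nontrivial Y] {p : Y × ℝ} (hp : p ∈ sphere (0 : Y × ℝ) 1) :
    ∃ y : Y, ‖y‖ ≤ 4 ∧ wrap y = p := by
  obtain ⟨z, s⟩ := p
  obtain ⟨⟨h1, h2⟩, h3⟩ := (mem_sph_prod _).1 hp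
  simp only [Real.norm_eq_abs] at h1 h2 h3
  rw [abs_le] at h2
  rcases h3 with h3 | h3
  · have hn : ‖(2 - s) • z‖ = 2 - s := by
      rw [norm_smul, h3, mul_one, Real.norm_eq_abs, abs_of_nonneg (by linarith)]
    refine ⟨(2 - s) • z, by linarith, ?_⟩
    rw [wrap_2 (by linarith) (by linarith), hn, smul_smul, inv_mul_cancel₀ (by linarith), one_smul]
    simp
  · rcases eq_or_eq_neg_of_abs_eq h3 with rfl | rfl
    · exact ⟨z, by linarith, wrap_1 h1⟩
    · rcases eq_or_ne z 0 with rfl | hz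
      · obtain ⟨y, hy⟩ := NormedSpace.exists_lt_norm ℝ Y 0
        have : ‖(4 / ‖y‖) • y‖ = 4 := by
          rw [norm_smul, norm_div, norm_norm, div_mul_cancel₀ _ hy.ne']; simp
        exact ⟨_, this.le, wrap_four this⟩
      · have hz0 : 0 < ‖z‖ := norm_pos_iff.2 hz
        have hn : ‖((4 - ‖z‖) / ‖z‖) • z‖ = 4 - ‖z‖ := by
          rw [norm_smul, Real.norm_eq_abs, abs_of_nonneg (div_nonneg (by linarith) hz0.le),
            div_mul_cancel₀ _ hz0.ne']
        refine ⟨((4 - ‖z‖) / ‖z‖) • z, by linarith, ?_⟩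
        rw [wrap_3 (by linarith), hn, smul_smul]
        have : (4 - (4 - ‖z‖)) / (4 - ‖z‖) * ((4 - ‖z‖) / ‖z‖) = 1 := by
          have : 4 - ‖z‖ ≠ 0 := by linarith
          field_simp; ring
        rw [this, one_smul]
end

/-- Filling spheres from the vanishing of a homotopy group, in the cubical model. -/
lemma fill_model {X : Type*} [TopologicalSpace X] (i : ℕ) (hi : 1 ≤ i)
    (hX : ∀ x : X, Subsingleton (HomotopyGroup (Fin i) X x)) (μ : (Fin i → ℝ) × ℝ → X)
    (hμ : ContinuousOn μ (sphere 0 1)) :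
    ∃ M : (Fin i → ℝ) × ℝ → X, ContinuousOn M (closedBall 0 1) ∧
      ∀ p ∈ sphere (0 : (Fin i → ℝ) × ℝ) 1, M p = μ p := by
  classical
  have : Nonempty (Fin i) := ⟨⟨0, hi⟩⟩
  let c : (Fin i → unitInterval) → (Fin i → ℝ) := fun x j => 4 * (2 * (x j : ℝ) - 1)
  have hc : Continuous c := by fun_prop
  have habs : ∀ x j, |c x j| ≤ 4 := by
    intro x j
    have h0 := (x j).2.1
    have h1 := (x j).2.2
    rw [abs_le]
    constructor <;> simp only [c] <;> linarith
  have hc4 : ∀ x, ‖c x‖ ≤ 4 := fun x => by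
    rw [pi_norm_le_iff_of_nonneg (by norm_num)]
    exact fun j => habs x j
  have hcb : ∀ x, ‖c x‖ = 4 ↔ x ∈ Cube.boundary (Fin i) := by
    intro x
    have hj : ∀ j, (|c x j| = 4 ↔ x j = 0 ∨ x j = 1) := by
      intro j
      rw [abs_eq (by norm_num), or_comm]
      simp only [c]
      refine or_congr ⟨fun h => ?_, fun h => ?_⟩ ⟨fun h => ?_, fun h => ?_⟩
      · apply Subtype.ext; show (x j : ℝ) = 0; linarith
      · rw [h]; norm_num
      · apply Subtype.ext; show (x j : ℝ) = 1; linarith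
      · rw [h]; norm_num
    constructor
    · intro h
      by_contra hx
      have : ‖c x‖ < 4 := by
        rw [pi_norm_lt_iff (by norm_num)]
        intro j
        refine lt_of_le_of_ne (habs x j) fun he => hx ⟨j, (hj j).1 he⟩
      linarith
    · rintro ⟨j, h⟩
      refine le_antisymm (hc4 x) ?_
      rw [← (hj j).2 h]
      exact norm_le_pi_norm (c x) j
  have hcinj : Function.Injective c := by
    intro x y h
    funext j
    have := congrFun h j
    simp only [c] at this
    apply Subtype.ext
    linarith
  have hcsurj : ∀ y : Fin i → ℝ, ‖y‖ ≤ 4 → ∃ x, c x = y := by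
    intro y hy
    rw [pi_norm_le_iff_of_nonneg (by norm_num)] at hy
    have hy' : ∀ j, -4 ≤ y j ∧ y j ≤ 4 := fun j => abs_le.1 (hy j)
    refine ⟨fun j => ⟨(y j / 4 + 1) / 2, by linarith [hy' j], by linarith [hy' j]⟩, ?_⟩
    funext j
    simp only [c]
    ring
  let x₀ : X := μ (0, -1)
  let γ : GenLoop (Fin i) X x₀ := ⟨⟨fun x => μ (wrap (c x)),
    hμ.comp_continuous (wrap_cont.comp hc) (fun x => wrap_mem (hc4 x))⟩, fun x hx => by
      simp only [ContinuousMap.coe_mk]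
      rw [wrap_four ((hcb x).2 hx)]⟩
  have hγ : GenLoop.Homotopic γ GenLoop.const := by
    have : (Quotient.mk _ γ : HomotopyGroup (Fin i) X x₀) = Quotient.mk _ GenLoop.const :=
      (hX x₀).elim _ _
    exact Quotient.exact this
  obtain ⟨G⟩ := hγ
  let Θ : unitInterval × (Fin i → unitInterval) → closedBall (0 : (Fin i → ℝ) × ℝ) 1 :=
    fun q => ⟨(q.1 : ℝ) • wrap (c q.2), by
      rw [mem_closedBall_zero_iff, norm_smul,
        mem_sphere_zero_iff_norm.1 (wrap_mem (hc4 q.2)), mul_one, Real.norm_eq_abs,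
        abs_of_nonneg q.1.2.1]
      exact q.1.2.2⟩
  have hΘn : ∀ q, ‖(Θ q : (Fin i → ℝ) × ℝ)‖ = q.1 := fun q => by
    simp only [Θ]
    rw [norm_smul, mem_sphere_zero_iff_norm.1 (wrap_mem (hc4 q.2)), mul_one, Real.norm_eq_abs,
        abs_of_nonneg q.1.2.1]
  have hΘc : Continuous Θ := by
    refine Continuous.subtype_mk ?_ _
    exact (continuous_subtype_val.comp continuous_fst).smul (wrap_cont.comp (hc.comp continuous_snd))
  have hΘs : Function.Surjective Θ := by
    rintro ⟨p, hp⟩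
    rcases eq_or_ne p 0 with rfl | hp0
    · exact ⟨(0, fun _ => 0), Subtype.ext (by simp [Θ])⟩
    · have hpos : 0 < ‖p‖ := norm_pos_iff.2 hp0
      obtain ⟨y, hy, hyp⟩ := wrap_surj (p := ‖p‖⁻¹ • p) (by
        rw [mem_sphere_zero_iff_norm, norm_smul, norm_inv, norm_norm, inv_mul_cancel₀ hpos.ne'])
      obtain ⟨x, rfl⟩ := hcsurj y hy
      refine ⟨(⟨‖p‖, norm_nonneg _, by simpa using hp⟩, x), Subtype.ext ?_⟩
      simp only [Θ]
      rw [hyp, smul_smul, mul_inv_cancel₀ hpos.ne', one_smul]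
  have hq : IsQuotientMap Θ := IsQuotientMap.of_surjective_continuous hΘs hΘc
  let F : unitInterval × (Fin i → unitInterval) → X := fun q => G (unitInterval.symm q.1, q.2)
  have hF : Continuous F := by
    refine G.continuous.comp ?_
    exact (unitInterval.continuous_symm.comp continuous_fst).prodMk continuous_snd
  have hGb : ∀ t, ∀ x ∈ Cube.boundary (Fin i), G (t, x) = x₀ := by
    intro t x hx
    rw [G.eq_fst t hx]
    exact γ.2 x hx
  have hcompat : ∀ q q', Θ q = Θ q' → F q = F q' := by
    rintro ⟨ρ, x⟩ ⟨ρ', x'⟩ h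
    have hρ : ρ = ρ' := by
      apply Subtype.ext
      have h1 := hΘn (ρ, x)
      have h2 := hΘn (ρ', x')
      rw [h] at h1
      exact h1.symm.trans h2
    subst hρ
    rcases eq_or_ne ρ 0 with rfl | h0
    · simp only [F, unitInterval.symm_zero]
      rw [G.apply_one, G.apply_one]
      rfl
    · have h0' : (ρ : ℝ) ≠ 0 := fun h => h0 (Subtype.ext h)
      have h1 : wrap (c x) = wrap (c x') := by
        have := congrArg Subtype.val h
        exact smul_right_injective _ h0' this
      rcases wrap_inj (hc4 x) (hc4 x') h1 with h2 | ⟨h2, h3⟩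
      · rw [hcinj h2]
      · simp only [F]
        rw [hGb _ _ ((hcb x).1 h2), hGb _ _ ((hcb x').1 h3)]
  let M₀ : closedBall (0 : (Fin i → ℝ) × ℝ) 1 → X := fun p => F (Function.surjInv hΘs p)
  have hM₀ : ∀ q, M₀ (Θ q) = F q := fun q => hcompat _ _ (Function.surjInv_eq hΘs _)
  have hM₀c : Continuous M₀ := by
    rw [hq.continuous_iff]
    exact hF.congr fun q => (hM₀ q).symm
  refine ⟨fun p => if h : p ∈ closedBall (0 : (Fin i → ℝ) × ℝ) 1 then M₀ ⟨p, h⟩ else x₀, ?_, ?_⟩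
  · rw [continuousOn_iff_continuous_domRestrict]
    refine hM₀c.congr fun p => ?_
    simp only [domRestrict_apply]
    rw [dif_pos p.2]
  · intro p hp
    have hp' := sphere_subset_closedBall hp
    simp only
    rw [dif_pos hp']
    obtain ⟨⟨ρ, x⟩, hx⟩ := hΘs ⟨p, hp'⟩
    have hρ : ρ = 1 := by
      apply Subtype.ext
      have := hΘn (ρ, x)
      rw [hx] at this
      simp only at this
      rw [← this]
      simpa using hp
    subst hρ
    rw [← hx, hM₀]
    simp only [F, unitInterval.symm_one]
    rw [G.apply_zero]
    have : p = wrap (c x) := by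
      have := congrArg Subtype.val hx
      simp only [Θ, Set.Icc.coe_one, one_smul] at this
      exact this.symm
    rw [this]
    rfl

/-- Filling spheres in an `n`-connected space. -/
lemma fill_sphere {X : Type*} [TopologicalSpace X] (n : ℕ) (hX : NConnectedSpace n X)
    (l : ℕ) (hl : l ≤ n + 1) (W : Type) [NormedAddCommGroup W] [NormedSpace ℝ W]
    [FiniteDimensional ℝ W] (hW : Module.finrank ℝ W = l) (μ : W → X)
    (hμ : ContinuousOn μ (sphere 0 1)) :
    ∃ M : W → X, ContinuousOn M (closedBall 0 1) ∧ ∀ p ∈ sphere (0 : W) 1, M p = μ p := by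
  obtain ⟨⟨x₀⟩, hpath, hpi⟩ := hX
  match l, hl, hW with
  | 0, _, hW =>
    have : Subsingleton W := Module.finrank_zero_iff.1 hW
    refine ⟨fun _ => x₀, continuousOn_const, fun p hp => ?_⟩
    rw [mem_sphere_zero_iff_norm, Subsingleton.elim p 0] at hp
    simp at hp
  | 1, _, hW =>
    obtain ⟨φ, hφ⟩ := ball_homeo W ℝ (by simp [hW])
    let γ := hpath.somePath (μ (φ.symm (-1))) (μ (φ.symm 1))
    refine ⟨fun w => γ.extend ((φ w + 1) / 2), ?_, ?_⟩
    · have := φ.continuous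
      exact (γ.continuous_extend.comp (by fun_prop)).continuousOn
    · intro p hp
      rw [mem_sphere_zero_iff_norm, ← hφ] at hp
      rcases eq_or_eq_neg_of_abs_eq (hp : |φ p| = 1) with h | h
      · have e : ((1 : ℝ) + 1) / 2 = 1 := by norm_num
        simp only [h, e, Path.extend_one]
        rw [← h, φ.symm_apply_apply]
      · have e : ((-1 : ℝ) + 1) / 2 = 0 := by norm_num
        simp only [h, e, Path.extend_zero]
        rw [← h, φ.symm_apply_apply]
  | i + 2, hl, hW =>
    obtain ⟨φ, hφ⟩ := ball_homeo W ((Fin (i + 1) → ℝ) × ℝ) (by simp [hW])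
    have hφ' : ∀ p, ‖φ.symm p‖ = ‖p‖ := fun p => by rw [← hφ, φ.apply_symm_apply]
    obtain ⟨M, hM, hM'⟩ := fill_model (i + 1) (by omega) (fun x => hpi x (i + 1) (by omega)
      (by omega)) (fun p => μ (φ.symm p)) (hμ.comp φ.symm.continuous.continuousOn (by
        intro p hp
        simpa [hφ'] using hp))
    refine ⟨fun w => M (φ w), hM.comp φ.continuous.continuousOn ?_, ?_⟩
    · intro w hw
      simpa [hφ] using hw
    · intro w hw
      show M (φ w) = μ w
      rw [hM' (φ w) (by simpa [hφ] using hw), φ.symm_apply_apply]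
/-- The relative lifting property for one pair of finite dimensional spaces. -/
def QOne (f : C(E, B)) (V W : Type) [NormedAddCommGroup V] [NormedAddCommGroup W] : Prop :=
  ∀ h : V → B, ContinuousOn h (closedBall 0 1) → ∀ lam : V × W → E,
    ContinuousOn lam (sphere 0 1) → (∀ p ∈ sphere (0 : V × W) 1, f (lam p) = h p.1) →
    ∃ Λ : V × W → E, ContinuousOn Λ (closedBall 0 1) ∧
      (∀ p ∈ closedBall (0 : V × W) 1, f (Λ p) = h p.1) ∧
      ∀ p ∈ sphere (0 : V × W) 1, Λ p = lam p

/-- The relative lifting property in dimensions `k` (base) and `l` (fibre). -/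
def QProp (f : C(E, B)) (k l : ℕ) : Prop :=
  ∀ (V W : Type) [NormedAddCommGroup V] [NormedSpace ℝ V] [FiniteDimensional ℝ V]
    [NormedAddCommGroup W] [NormedSpace ℝ W] [FiniteDimensional ℝ W],
    Module.finrank ℝ V = k → Module.finrank ℝ W = l → QOne f V W

lemma QOne.transfer {V V' W : Type} [NormedAddCommGroup V] [NormedAddCommGroup V']
    [NormedAddCommGroup W] (φ : V ≃ₜ V') (hφ : ∀ v, ‖φ v‖ = ‖v‖) (hQ : QOne f V' W) :
    QOne f V W := by
  intro h hh lam hlam hl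
  have hφ' : ∀ v, ‖φ.symm v‖ = ‖v‖ := fun v => by rw [← hφ, φ.apply_symm_apply]
  have c1 := φ.continuous
  have c2 := φ.symm.continuous
  obtain ⟨Λ, h1, h2, h3⟩ := hQ (fun v => h (φ.symm v))
    (hh.comp c2.continuousOn fun v hv => by simpa [hφ'] using hv)
    (fun p => lam (φ.symm p.1, p.2))
    (hlam.comp (Continuous.continuousOn (by fun_prop)) fun p hp => by
      simpa only [mem_sph_prod, hφ'] using hp)
    (fun p hp => hl (φ.symm p.1, p.2) (by simpa only [mem_sph_prod, hφ'] using hp))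
  refine ⟨fun p => Λ (φ p.1, p.2), h1.comp (Continuous.continuousOn (by fun_prop)) fun p hp => by
      simpa only [mem_cb_prod, hφ] using hp, fun p hp => ?_, fun p hp => ?_⟩
  · have := h2 (φ p.1, p.2) (by simpa only [mem_cb_prod, hφ] using hp)
    simpa using this
  · have := h3 (φ p.1, p.2) (by simpa only [mem_sph_prod, hφ] using hp)
    simpa using this

lemma QProp.base {n : ℕ} (hfib : ∀ b : B, NConnectedSpace n {e : E // f e = b}) (l : ℕ)
    (hl : l ≤ n + 1) : QProp f 0 l := by
  classical
  intro V W _ _ _ _ _ _ hV hW h hh lam hlam hlift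
  have : Subsingleton V := Module.finrank_zero_iff.1 hV
  have hs : ∀ w : W, w ∈ sphere (0 : W) 1 → ((0 : V), w) ∈ sphere (0 : V × W) 1 := by
    intro w hw
    rw [mem_sphere_zero_iff_norm] at hw
    rw [mem_sph_prod]
    simp [hw]
  have e0 : ∀ p : V × W, p = (0, p.2) := fun p => Prod.ext (Subsingleton.elim _ _) rfl
  obtain ⟨x₀⟩ := (hfib (h 0)).1
  let μ : W → {e : E // f e = h 0} := fun w =>
    if hw : w ∈ sphere (0 : W) 1 then ⟨lam (0, w), hlift _ (hs w hw)⟩ else x₀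
  have hμe : ∀ w ∈ sphere (0 : W) 1, (μ w : E) = lam (0, w) := fun w hw => by
    simp only [μ]
    rw [dif_pos hw]
  have hμ : ContinuousOn μ (sphere 0 1) := by
    refine (IsInducing.continuousOn_iff (Topology.IsInducing.subtypeVal (t := {e : E | f e = h 0}))).2 ?_
    refine ContinuousOn.congr (f := fun w => lam (0, w)) ?_ hμe
    exact hlam.comp (Continuous.continuousOn (by fun_prop)) hs
  obtain ⟨M, hM, hM'⟩ := fill_sphere n (hfib (h 0)) l hl W hW μ hμ
  refine ⟨fun p => (M p.2 : E), ?_, ?_, ?_⟩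
  · refine continuous_subtype_val.comp_continuousOn (hM.comp continuous_snd.continuousOn ?_)
    intro p hp
    simpa using ((mem_cb_prod p).1 hp).2
  · intro p hp
    rw [(M p.2).2, Subsingleton.elim p.1 0]
  · intro p hp
    have hp2 : p.2 ∈ sphere (0 : W) 1 := by
      rw [mem_sph_prod, Subsingleton.elim p.1 0] at hp
      simpa using hp.2
    show (M p.2 : E) = lam p
    rw [hM' _ hp2, hμe _ hp2, ← e0]

/-- Clamping to `[-1,1]`. -/
noncomputable def clamp (t : ℝ) : ℝ := max (-1) (min 1 t)

lemma clamp_cont : Continuous clamp := by unfold clamp; fun_prop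

lemma clamp_abs (t : ℝ) : ‖clamp t‖ ≤ 1 := by
  rw [Real.norm_eq_abs, abs_le]
  exact ⟨le_max_left _ _, max_le (by norm_num) (min_le_left _ _)⟩

lemma clamp_eq {t : ℝ} (h : t ∈ Icc (-1 : ℝ) 1) : clamp t = t := by
  unfold clamp
  rw [min_eq_right h.2, max_eq_right h.1]

lemma QProp.slab {k l : ℕ} (h1 : QProp f k l) (h2 : QProp f k (l + 1)) {K W : Type}
    [NormedAddCommGroup K] [NormedSpace ℝ K] [FiniteDimensional ℝ K]
    [NormedAddCommGroup W] [NormedSpace ℝ W] [FiniteDimensional ℝ W]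
    (hK : Module.finrank ℝ K = k) (hW : Module.finrank ℝ W = l) (h : ℝ × K → B)
    (hh : ContinuousOn h (closedBall 0 1)) (lam : (ℝ × K) × W → E)
    (hlam : ContinuousOn lam (sphere 0 1))
    (hl : ∀ p ∈ sphere (0 : (ℝ × K) × W) 1, f (lam p) = h p.1) :
    Slab f (fun q : ℝ × (K × W) => h (clamp q.1, q.2.1))
      (fun q : ℝ × (K × W) => lam ((clamp q.1, q.2.1), q.2.2)) := by
  classical
  have cc := clamp_cont
  have hb : ∀ t, ∀ v : K, ‖v‖ ≤ 1 → (clamp t, v) ∈ closedBall (0 : ℝ × K) 1 := fun t v hv =>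
    (mem_cb_prod _).2 ⟨clamp_abs t, hv⟩
  have hs : ∀ t, ∀ u ∈ sphere (0 : K × W) 1,
      ((clamp t, u.1), u.2) ∈ sphere (0 : (ℝ × K) × W) 1 := by
    intro t u hu
    rw [mem_sph_prod] at hu ⊢
    have hn : ‖(clamp t, u.1)‖ ≤ 1 := by simpa using hb t u.1 hu.1.1
    refine ⟨⟨hn, hu.1.2⟩, hu.2.imp_left fun h1 => le_antisymm hn ?_⟩
    rw [← h1]
    exact norm_snd_le (clamp t, u.1)
  refine ⟨?_, ?_, ?_, ?_, ?_⟩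
  · exact hh.comp (Continuous.continuousOn (by fun_prop)) fun q hq =>
      hb _ _ ((mem_cb_prod _).1 hq.2).1
  · exact hlam.comp (Continuous.continuousOn (by fun_prop)) fun q hq => hs _ _ hq.2
  · exact fun t u hu => hl _ (hs t u hu)
  · intro t
    obtain ⟨g, g1, g2, g3⟩ := h1 K W hK hW (fun v => h (clamp t, v))
      (hh.comp (Continuous.continuousOn (by fun_prop)) fun v hv => hb t v (by simpa using hv))
      (fun p => lam ((clamp t, p.1), p.2))
      (hlam.comp (Continuous.continuousOn (by fun_prop)) fun q hq => hs _ _ hq)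
      (fun p hp => hl _ (hs t p hp))
    exact ⟨g, g1, g2, g3⟩
  · intro t g₀ g₁ hg₀ hg₁
    let ν : K × (W × ℝ) → E := fun p =>
      if p.2.2 ≤ 0 then g₀ (p.1, p.2.1) else g₁ (p.1, p.2.1)
    have hcb : ∀ p ∈ sphere (0 : K × (W × ℝ)) 1, (p.1, p.2.1) ∈ closedBall (0 : K × W) 1 := by
      intro p hp
      have := sphere_subset_closedBall hp
      rw [mem_cb_prod] at this ⊢
      exact ⟨this.1, (norm_fst_le p.2).trans this.2⟩
    have hsp : ∀ p ∈ sphere (0 : K × (W × ℝ)) 1, ‖p.2.2‖ ≠ 1 →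
        (p.1, p.2.1) ∈ sphere (0 : K × W) 1 := by
      intro p hp hne
      have hc := (mem_cb_prod _).1 (hcb p hp)
      rw [mem_sph_prod] at hp ⊢
      refine ⟨hc, hp.2.imp_right fun h => ?_⟩
      have := (mem_sph_prod p.2).1 (by simpa using h)
      exact this.2.resolve_right hne
    have hν0 : ∀ p ∈ sphere (0 : K × (W × ℝ)) 1, p.2.2 ≤ 0 → ν p = g₀ (p.1, p.2.1) :=
      fun p _ h => if_pos h
    have hν1 : ∀ p ∈ sphere (0 : K × (W × ℝ)) 1, 0 ≤ p.2.2 → ν p = g₁ (p.1, p.2.1) := by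
      intro p hp h
      rcases h.eq_or_lt with h | h
      · have hu := hsp p hp (by rw [← h]; simp)
        rw [hν0 p hp h.ge, hg₀.bdry _ hu, hg₁.bdry _ hu]
      · exact if_neg h.not_ge
    have hνc : ContinuousOn ν (sphere 0 1) := by
      refine glue_cont (s := {p : K × (W × ℝ) | p.2.2 ≤ 0})
        (t := {p : K × (W × ℝ) | 0 ≤ p.2.2})
        (isClosed_le (by fun_prop) (by fun_prop)) (isClosed_le (by fun_prop) (by fun_prop))
        (fun p _ => le_total p.2.2 0) ν ?_ ?_
      · refine ContinuousOn.congr (f := fun p => g₀ (p.1, p.2.1)) ?_ fun p hp => hν0 p hp.1 hp.2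
        exact hg₀.cont.comp (Continuous.continuousOn (by fun_prop)) fun p hp => hcb p hp.1
      · refine ContinuousOn.congr (f := fun p => g₁ (p.1, p.2.1)) ?_ fun p hp => hν1 p hp.1 hp.2
        exact hg₁.cont.comp (Continuous.continuousOn (by fun_prop)) fun p hp => hcb p hp.1
    obtain ⟨Λ, g1, g2, g3⟩ := h2 K (W × ℝ) hK (by simp [hW]) (fun v => h (clamp t, v))
      (hh.comp (Continuous.continuousOn (by fun_prop)) fun v hv => hb t v (by simpa using hv))
      ν hνc (by
        intro p hp
        rcases le_total p.2.2 0 with h0 | h0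
        · rw [hν0 p hp h0, hg₀.lift _ (hcb p hp)]
        · rw [hν1 p hp h0, hg₁.lift _ (hcb p hp)])
    refine ⟨fun p => Λ (p.1.1, (p.1.2, p.2)), ?_, ?_, ?_, ?_, ?_⟩
    · refine g1.comp (Continuous.continuousOn (by fun_prop)) fun p hp => ?_
      simp only [mem_closedBall_zero_iff, Prod.norm_def, max_le_iff] at hp ⊢
      tauto
    · intro p hp
      refine g2 (p.1.1, (p.1.2, p.2)) ?_
      simp only [mem_closedBall_zero_iff, Prod.norm_def, max_le_iff] at hp ⊢
      tauto
    · intro u hu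
      have hm : (u.1, (u.2, (-1 : ℝ))) ∈ sphere (0 : K × (W × ℝ)) 1 := by
        rw [mem_cb_prod] at hu
        simp only [mem_sphere_zero_iff_norm, Prod.norm_def, norm_neg, norm_one]
        rw [max_eq_right hu.2, max_eq_right hu.1]
      show Λ (u.1, (u.2, (-1 : ℝ))) = g₀ u
      rw [g3 _ hm, hν0 _ hm (by norm_num)]
    · intro u hu
      have hm : (u.1, (u.2, (1 : ℝ))) ∈ sphere (0 : K × (W × ℝ)) 1 := by
        rw [mem_cb_prod] at hu
        simp only [mem_sphere_zero_iff_norm, Prod.norm_def, norm_one]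
        rw [max_eq_right hu.2, max_eq_right hu.1]
      show Λ (u.1, (u.2, (1 : ℝ))) = g₁ u
      rw [g3 _ hm, hν1 _ hm (by norm_num)]
    · intro u hu s hs'
      have hsn : ‖s‖ ≤ 1 := abs_le.2 hs'
      have hm : (u.1, (u.2, s)) ∈ sphere (0 : K × (W × ℝ)) 1 := by
        simp only [mem_sphere_zero_iff_norm, Prod.norm_def] at hu ⊢
        rw [← max_assoc, hu, max_eq_left hsn]
      show Λ (u.1, (u.2, s)) = _
      rw [g3 _ hm]
      rcases le_total s 0 with h0 | h0
      · rw [hν0 _ hm h0, hg₀.bdry _ hu]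
      · rw [hν1 _ hm h0, hg₁.bdry _ hu]

lemma QProp.step (hm : IsSerreMicrofibration f) {k l : ℕ} (h1 : QProp f k l)
    (h2 : QProp f k (l + 1)) : QProp f (k + 1) l := by
  intro V W _ _ _ _ _ _ hV hW
  obtain ⟨φ, hφ⟩ := ball_homeo V (ℝ × (Fin k → ℝ)) (by simp [hV, add_comm])
  refine QOne.transfer φ hφ ?_
  intro h hh lam hlam hl
  have hS := QProp.slab h1 h2 (K := Fin k → ℝ) (by simp) hW h hh lam hlam hl
  have hend : ∀ t : ℝ, ‖t‖ = 1 → IsSlice f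
      (fun q : ℝ × ((Fin k → ℝ) × W) => h (clamp q.1, q.2.1))
      (fun q : ℝ × ((Fin k → ℝ) × W) => lam ((clamp q.1, q.2.1), q.2.2)) t
      (fun u => lam ((t, u.1), u.2)) := by
    intro t ht
    have hct : clamp t = t := clamp_eq (abs_le.1 (le_of_eq ht))
    have hmem : ∀ u ∈ closedBall (0 : (Fin k → ℝ) × W) 1,
        ((t, u.1), u.2) ∈ sphere (0 : (ℝ × (Fin k → ℝ)) × W) 1 := by
      intro u hu
      rw [mem_cb_prod] at hu
      simp only [mem_sphere_zero_iff_norm, Prod.norm_def, ht]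
      rw [max_eq_left hu.1, max_eq_left hu.2]
    refine ⟨hlam.comp (Continuous.continuousOn (by fun_prop)) hmem, ?_, ?_⟩
    · intro u hu
      simp only [hct]
      exact hl _ (hmem u hu)
    · intro u hu
      simp only [hct]
  obtain ⟨Λ, hΛ, ha, hb⟩ := hS.solve hm (a := -1) (b := 1) (by norm_num)
    (hend (-1) (by simp)) (hend 1 (by simp))
  have hmem : ∀ p ∈ closedBall (0 : (ℝ × (Fin k → ℝ)) × W) 1,
      p.1.1 ∈ Icc (-1 : ℝ) 1 ∧ (p.1.2, p.2) ∈ closedBall (0 : (Fin k → ℝ) × W) 1 := by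
    intro p hp
    simp only [mem_closedBall_zero_iff, Prod.norm_def, max_le_iff] at hp ⊢
    exact ⟨abs_le.1 hp.1.1, hp.1.2, hp.2⟩
  refine ⟨fun p => Λ (p.1.1, (p.1.2, p.2)), ?_, ?_, ?_⟩
  · exact hΛ.cont.comp (Continuous.continuousOn (by fun_prop)) fun p hp => hmem p hp
  · intro p hp
    have := hΛ.lift _ (hmem p hp).1 _ (hmem p hp).2
    simpa only [clamp_eq (hmem p hp).1] using this
  · intro p hp
    obtain ⟨m1, m2⟩ := hmem p (sphere_subset_closedBall hp)
    show Λ (p.1.1, (p.1.2, p.2)) = lam p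
    by_cases hu : (p.1.2, p.2) ∈ sphere (0 : (Fin k → ℝ) × W) 1
    · rw [hΛ.bdry _ m1 _ hu]
      simp only [clamp_eq m1]
    · have ht : |p.1.1| = 1 := by
        rw [mem_sphere_zero_iff_norm, Prod.norm_def, Prod.norm_def, max_assoc] at hp
        rcases max_choice ‖p.1.1‖ (max ‖p.1.2‖ ‖p.2‖) with h' | h'
        · rw [h'] at hp; exact hp
        · rw [h'] at hp
          exact absurd (by rw [mem_sphere_zero_iff_norm, Prod.norm_def]; exact hp) hu
      rcases eq_or_eq_neg_of_abs_eq ht with h' | h'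
      · rw [h', hb _ m2]
        simp only [← h']
      · rw [h', ha _ m2]
        simp only [← h']

lemma QProp.all (hm : IsSerreMicrofibration f) {n : ℕ}
    (hfib : ∀ b : B, NConnectedSpace n {e : E // f e = b}) (k : ℕ) :
    ∀ l, k + l ≤ n + 1 → QProp f k l := by
  induction k with
  | zero => exact fun l hl => QProp.base hfib l (by omega)
  | succ k ih => exact fun l hl => QProp.step hm (ih l (by omega)) (ih (l + 1) (by omega))

end Aux

/-- If `f : E → B` is a Serre microfibration with all fibers `n`-connected, then `f`
is `(n+1)`-connected as a map: it is surjective on path components, and for every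
`i ≤ n` each lifting square of `S^i → E` against `D^{i+1} → B` admits a lift whose
upper triangle commutes strictly and whose lower triangle commutes up to homotopy
relative to `S^i`. -/
theorem serreMicrofibration_connectivity {E B : Type*} [TopologicalSpace E]
    [TopologicalSpace B] (f : C(E, B)) (n : ℕ)
    (hmicro : IsSerreMicrofibration f)
    (hfib : ∀ b : B, NConnectedSpace n {e : E // f e = b}) :
    (∀ b : B, ∃ e : E, Joined (f e) b) ∧
      ∀ i ≤ n,
        ∀ (g : C(sphere (0 : EuclideanSpace ℝ (Fin (i + 1))) 1, E))
          (h : C(closedBall (0 : EuclideanSpace ℝ (Fin (i + 1))) 1, B)),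
          (∀ x, f (g x) = h (sphereToDisk (i + 1) x)) →
          ∃ L : C(closedBall (0 : EuclideanSpace ℝ (Fin (i + 1))) 1, E),
            (∀ x, L (sphereToDisk (i + 1) x) = g x) ∧
            (f.comp L).HomotopicRel h
              {y | (y : EuclideanSpace ℝ (Fin (i + 1))) ∈
                sphere (0 : EuclideanSpace ℝ (Fin (i + 1))) 1} := by
  classical
  refine ⟨fun b => ?_, fun i hi g h hgh => ?_⟩
  · obtain ⟨e⟩ := (hfib b).1
    exact ⟨e.1, by rw [e.2]⟩
  · let V := EuclideanSpace ℝ (Fin (i + 1))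
    let h0 : closedBall (0 : V) 1 := ⟨0, by simp⟩
    obtain ⟨e⟩ := (hfib (h h0)).1
    have hz : ‖(0 : Fin 0 → ℝ)‖ = 0 := norm_zero
    have hs : ∀ p : V × (Fin 0 → ℝ), p ∈ sphere (0 : V × (Fin 0 → ℝ)) 1 →
        p.1 ∈ sphere (0 : V) 1 := by
      intro p hp
      rw [mem_sph_prod, Subsingleton.elim p.2 0, hz] at hp
      simpa using hp.2
    let lam : V × (Fin 0 → ℝ) → E := fun p =>
      if hp : p.1 ∈ sphere (0 : V) 1 then g ⟨p.1, hp⟩ else e.1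
    let hx : V → B := fun v => if hv : v ∈ closedBall (0 : V) 1 then h ⟨v, hv⟩ else h h0
    have hxe : ∀ v (hv : v ∈ closedBall (0 : V) 1), hx v = h ⟨v, hv⟩ := fun v hv => dif_pos hv
    have hle : ∀ p (hp : p ∈ sphere (0 : V × (Fin 0 → ℝ)) 1), lam p = g ⟨p.1, hs p hp⟩ :=
      fun p hp => dif_pos (hs p hp)
    obtain ⟨Λ, L1, L2, L3⟩ := QProp.all hmicro hfib (i + 1) 0 (by omega) V (Fin 0 → ℝ)
      (by simp [V]) (by simp) hx (by
        rw [continuousOn_iff_continuous_domRestrict]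
        exact h.continuous.congr fun v => (hxe v.1 v.2).symm) lam (by
        rw [continuousOn_iff_continuous_domRestrict]
        have : Continuous fun p : sphere (0 : V × (Fin 0 → ℝ)) 1 => g ⟨p.1.1, hs p.1 p.2⟩ :=
          g.continuous.comp (by fun_prop)
        exact this.congr fun p => (hle p.1 p.2).symm) (by
        intro p hp
        rw [hle p hp, hgh, hxe _ (sphere_subset_closedBall (hs p hp))]
        rfl)
    have hm1 : ∀ v ∈ closedBall (0 : V) 1,
        (v, (0 : Fin 0 → ℝ)) ∈ closedBall (0 : V × (Fin 0 → ℝ)) 1 := by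
      intro v hv
      rw [mem_cb_prod, hz]
      simpa using hv
    have hm2 : ∀ v ∈ sphere (0 : V) 1,
        (v, (0 : Fin 0 → ℝ)) ∈ sphere (0 : V × (Fin 0 → ℝ)) 1 := by
      intro v hv
      rw [mem_sphere_zero_iff_norm] at hv
      rw [mem_sph_prod, hz]
      simp [hv]
    let Lf : C(closedBall (0 : V) 1, E) := ⟨fun v => Λ (v.1, 0),
      L1.comp_continuous (by fun_prop) fun v => hm1 v.1 v.2⟩
    refine ⟨Lf, fun x => ?_, ?_⟩
    · show Λ (x.1, 0) = g x
      rw [L3 _ (hm2 _ x.2), hle _ (hm2 _ x.2)]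
    · have : f.comp Lf = h := by
        ext v
        show f (Λ (v.1, 0)) = h v
        rw [L2 _ (hm1 _ v.2), hxe _ v.2]
      rw [this]
      exact ContinuousMap.HomotopicRel.refl h
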